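/- Let C be a permutation class avoiding the decreasing permutation δ_{m+1}, and suppose C ⊆ A₁ ∘ A₂ ∘ ⋯ ∘ A_k where each A_i is a subclass of C. Then C is contained in the merge of m^{k−1} copies of A₁, i.e., C ⊆ A₁ ⊙ A₁ ⊙ ⋯ ⊙ A₁ (m^{k−1} copies). -/

import Mathlib

/-- A permutation of some finite length `n`, bundled with its length. -/
abbrev PermOn : Type := Σ n : ℕ, Equiv.Perm (Fin n)

/-- Pattern containment: `PattLe σ π` means the permutation `π` contains the
pattern `σ`, i.e. there are positions `f u` (strictly increasing in `u`)
whose values in `π` are order isomorphic to `σ`. -/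
def PattLe (σ π : PermOn) : Prop :=
  ∃ f : Fin σ.1 ↪o Fin π.1, ∀ u v : Fin σ.1, σ.2 u < σ.2 v ↔ π.2 (f u) < π.2 (f v)

/-- A permutation class: a set of permutations closed downward under
pattern containment. -/
def IsPermClass (C : Set PermOn) : Prop :=
  ∀ π ∈ C, ∀ σ : PermOn, PattLe σ π → σ ∈ C

/-- The class `C` avoids the permutation `τ`: no element of `C` contains `τ`. -/
def ClassAvoids (C : Set PermOn) (τ : PermOn) : Prop :=
  ∀ σ ∈ C, ¬ PattLe τ σ

/-- `IsMerge σ α β`: the entries of `σ` can be colored red/blue so that the red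
subsequence is order isomorphic to `α` and the blue one to `β`.  The red
positions are the range of `f`, the blue positions the range of `g`. -/
def IsMerge (σ α β : PermOn) : Prop :=
  ∃ (f : Fin α.1 ↪o Fin σ.1) (g : Fin β.1 ↪o Fin σ.1),
    (∀ u v, f u ≠ g v) ∧
    (∀ i : Fin σ.1, (∃ u, f u = i) ∨ (∃ v, g v = i)) ∧
    (∀ u v, α.2 u < α.2 v ↔ σ.2 (f u) < σ.2 (f v)) ∧
    (∀ u v, β.2 u < β.2 v ↔ σ.2 (g u) < σ.2 (g v))

/-- The merge `A ⊙ B` of two classes. -/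
def MergeClass (A B : Set PermOn) : Set PermOn :=
  { σ | ∃ α ∈ A, ∃ β ∈ B, IsMerge σ α β }

/-- The class consisting only of the empty permutation; it is a two-sided
identity for merging, used as base case for iterated merges. -/
def EmptyPermClass : Set PermOn := { σ | σ.1 = 0 }

/-- Iterated merge `A₁ ⊙ A₂ ⊙ ⋯ ⊙ A_k` of a list of classes. -/
def MergeAll (l : List (Set PermOn)) : Set PermOn :=
  l.foldr MergeClass EmptyPermClass

/-- A class is splittable if it is contained in the merge of finitely many
(at least one) proper subclasses. -/
def Splittable (C : Set PermOn) : Prop :=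
  ∃ As : List (Set PermOn), As ≠ [] ∧ (∀ A ∈ As, IsPermClass A ∧ A ⊂ C) ∧
    C ⊆ MergeAll As

/-- The increasing permutation `ι_n = 1 2 ⋯ n`. -/
def iota (n : ℕ) : PermOn := ⟨n, 1⟩

/-- The decreasing permutation `δ_n = n (n-1) ⋯ 1`. -/
def delta (n : ℕ) : PermOn := ⟨n, Fin.revPerm⟩

/-- The class `I` of all increasing permutations. -/
def Iclass : Set PermOn := Set.range iota

/-- The class `D` of all decreasing permutations. -/
def Dclass : Set PermOn := Set.range delta

/-- The class `I_m` of all permutations avoiding `δ_{m+1}`. -/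
def Im (m : ℕ) : Set PermOn := { σ | ¬ PattLe (delta (m + 1)) σ }

/-- The class `D_m` of all permutations avoiding `ι_{m+1}`. -/
def Dm (m : ℕ) : Set PermOn := { σ | ¬ PattLe (iota (m + 1)) σ }

/-- The composition `A ∘ B` of two classes: all `α ∘ β` with `α ∈ A`, `β ∈ B`
of the same length, where `(α ∘ β) i = α (β i)`. -/
def CompClass (A B : Set PermOn) : Set PermOn :=
  { σ | ∃ (n : ℕ) (α β : Equiv.Perm (Fin n)),
      (⟨n, α⟩ : PermOn) ∈ A ∧ (⟨n, β⟩ : PermOn) ∈ B ∧ σ = ⟨n, α * β⟩ }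

/-- The class of all identity permutations; a two-sided identity for
composition of classes, used as base case for iterated compositions. -/
def IdPermClass : Set PermOn := { σ | σ.2 = 1 }

/-- Iterated composition `A₁ ∘ A₂ ∘ ⋯ ∘ A_k` of a list of classes. -/
def CompAll (l : List (Set PermOn)) : Set PermOn :=
  l.foldr CompClass IdPermClass

/-- A class is composable if it is contained in the composition of finitely
many (at least one) proper subclasses. -/
def Composable (C : Set PermOn) : Prop :=
  ∃ As : List (Set PermOn), As ≠ [] ∧ (∀ A ∈ As, IsPermClass A ∧ A ⊂ C) ∧
    C ⊆ CompAll As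

/-- `IsInflation τ π σs`: `τ` is the inflation `π[σs 0, …, σs (n-1)]`.
The bijection `b` sends the `j`-th entry of the `i`-th block to its position in
`τ`; blocks occupy consecutive positions ordered as in `π`'s positions, within
a block positions are ordered as in `σs i`, values of distinct blocks compare
as the corresponding values of `π`, and values within a block compare as in
`σs i`. -/
def IsInflation (τ π : PermOn) (σs : Fin π.1 → PermOn) : Prop :=
  ∃ b : (Σ i : Fin π.1, Fin (σs i).1) ≃ Fin τ.1,
    (∀ (i i' : Fin π.1) (j : Fin (σs i).1) (j' : Fin (σs i').1),
        i < i' → b ⟨i, j⟩ < b ⟨i', j'⟩) ∧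
    (∀ (i : Fin π.1) (j j' : Fin (σs i).1), b ⟨i, j⟩ < b ⟨i, j'⟩ ↔ j < j') ∧
    (∀ (i i' : Fin π.1) (j : Fin (σs i).1) (j' : Fin (σs i').1), i ≠ i' →
        (τ.2 (b ⟨i, j⟩) < τ.2 (b ⟨i', j'⟩) ↔ π.2 i < π.2 i')) ∧
    (∀ (i : Fin π.1) (j j' : Fin (σs i).1),
        τ.2 (b ⟨i, j⟩) < τ.2 (b ⟨i, j'⟩) ↔ (σs i).2 j < (σs i).2 j')

/-- The inflation `A[B]` of the class `A` by the class `B`: all inflations of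
an element of `A` by (nonempty) elements of `B`. -/
def InflClass (A B : Set PermOn) : Set PermOn :=
  { τ | ∃ π ∈ A, ∃ σs : Fin π.1 → PermOn,
      (∀ i, σs i ∈ B ∧ 0 < (σs i).1) ∧ IsInflation τ π σs }

/-- The direct sum `α ⊕ β` of two permutations. -/
def dsum (α β : PermOn) : PermOn :=
  ⟨α.1 + β.1, finSumFinEquiv.symm.trans ((α.2.sumCongr β.2).trans finSumFinEquiv)⟩

/-- Iterated direct sum `π₁ ⊕ π₂ ⊕ ⋯ ⊕ π_n` of a list of permutations. -/
def bigDsum : List PermOn → PermOn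
  | [] => ⟨0, 1⟩
  | p :: l => dsum p (bigDsum l)

/-- The reversal `π^r` of a permutation `π`. -/
def revP (p : PermOn) : PermOn := ⟨p.1, p.2 * Fin.revPerm⟩

/-- Composition of two bundled permutations of the same length,
`(pcomp a b) i = a (b i)`; if the lengths differ it defaults to `a`. -/
def pcomp (a b : PermOn) : PermOn :=
  if h : b.1 = a.1 then ⟨a.1, a.2 * (finCongr h).permCongr b.2⟩ else a

/-- Every set of positions of a permutation carries a pattern. -/
theorem exists_pattern_of_finset {n : ℕ} (σ : Equiv.Perm (Fin n)) (s : Finset (Fin n)) :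
    ∃ (τ : PermOn) (f : Fin τ.1 ↪o Fin n), (∀ i, (∃ u, f u = i) ↔ i ∈ s) ∧
      ∀ u v, τ.2 u < τ.2 v ↔ σ (f u) < σ (f v) := by
  have hcard : (s.map σ.toEmbedding).card = s.card := Finset.card_map _
  let e : Fin s.card ≃o s := s.orderIsoOfFin rfl
  let e' : Fin s.card ≃o (s.map σ.toEmbedding : Finset (Fin n)) :=
    (s.map σ.toEmbedding).orderIsoOfFin hcard
  let r : s ≃ (s.map σ.toEmbedding : Finset (Fin n)) :=
    σ.subtypeEquiv fun a => by simp
  refine ⟨⟨s.card, (e.toEquiv.trans r).trans e'.symm.toEquiv⟩, s.orderEmbOfFin rfl, ?_, ?_⟩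
  · intro i
    have h := Finset.range_orderEmbOfFin s rfl
    rw [← Finset.mem_coe, ← h, Set.mem_range]
  · intro u v
    change e'.symm (r (e u)) < e'.symm (r (e v)) ↔ _
    rw [OrderIso.lt_iff_lt]
    rfl

/-- A permutation avoiding `δ_{m+1}` splits into `m` increasing subsequences. -/
theorem exists_increasing_coloring {m n : ℕ} (α : Equiv.Perm (Fin n))
    (h : ¬ PattLe (delta (m + 1)) ⟨n, α⟩) :
    ∃ c : Fin n → Fin m, ∀ i j, i < j → c i = c j → α i < α j := by
  classical
  let D : Fin n → Finset (Finset (Fin n)) := fun i =>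
    {s | i ∈ s ∧ (∀ x ∈ s, x ≤ i) ∧ StrictAntiOn α (s : Set (Fin n))}
  have card_le : ∀ i, ∀ s ∈ D i, s.card ≤ m := by
    intro i s hs
    by_contra! hlt
    obtain ⟨t, hts, ht⟩ := Finset.exists_subset_card_eq (Nat.succ_le_of_lt hlt)
    have hanti : StrictAntiOn α (s : Set (Fin n)) := ((Finset.mem_filter.1 hs).2).2.2
    have hmem (u : Fin (m + 1)) : t.orderEmbOfFin ht u ∈ (s : Set (Fin n)) :=
      hts (t.orderEmbOfFin_mem ht u)
    refine h ⟨t.orderEmbOfFin ht, fun u v => ?_⟩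
    change Fin.rev u < Fin.rev v ↔ α (t.orderEmbOfFin ht u) < α (t.orderEmbOfFin ht v)
    rw [Fin.rev_lt_rev, hanti.lt_iff_gt (hmem u) (hmem v)]
    exact (t.orderEmbOfFin ht).lt_iff_lt.symm
  have singleton_mem : ∀ i, {i} ∈ D i := fun i => by simp [D]
  let d : Fin n → ℕ := fun i => (D i).sup Finset.card
  have d_pos : ∀ i, 1 ≤ d i := fun i =>
    (Finset.card_singleton i).ge.trans (Finset.le_sup (f := Finset.card) (singleton_mem i))
  have d_le : ∀ i, d i ≤ m := fun i => Finset.sup_le (card_le i)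
  refine ⟨fun i => ⟨d i - 1, by have := d_pos i; have := d_le i; omega⟩, fun i j hij hc => ?_⟩
  have hd : d i = d j := by
    have := Fin.mk.inj hc
    have := d_pos i
    have := d_pos j
    omega
  by_contra hlt
  have hji : α j < α i :=
    lt_of_le_of_ne (not_lt.1 hlt) fun e => hij.ne' (α.injective e)
  obtain ⟨s, hs, hsd⟩ := Finset.exists_mem_eq_sup (D i) ⟨_, singleton_mem i⟩ Finset.card
  obtain ⟨-, his, hmax, hanti⟩ := Finset.mem_filter.1 hs
  have hjs : j ∉ s := fun hj => (hmax j hj).not_gt hij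
  have hins : insert j s ∈ D j := by
    refine Finset.mem_filter.2 ⟨Finset.mem_univ _, Finset.mem_insert_self _ _, ?_, ?_⟩
    · intro x hx
      rcases Finset.mem_insert.1 hx with rfl | hx
      · exact le_rfl
      · exact (hmax x hx).trans hij.le
    · intro x hx y hy hxy
      have hle : ∀ z ∈ s, α i ≤ α z := fun z hz => hanti.antitoneOn hz his (hmax z hz)
      rcases Finset.mem_insert.1 hx with rfl | hx <;> rcases Finset.mem_insert.1 hy with rfl | hy
      · exact absurd hxy (lt_irrefl _)
      · exact absurd (hxy.trans_le (hmax y hy)) hij.not_gt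
      · exact hji.trans_le (hle x ‹_›)
      · exact hanti hx hy hxy
  have hle : (insert j s).card ≤ d j := Finset.le_sup (f := Finset.card) hins
  rw [Finset.card_insert_of_notMem hjs] at hle
  have : d i = s.card := hsd
  omega

/-- A composition of `k` permutations avoiding `δ_{m+1}` splits into `m ^ k` increasing
subsequences. -/
theorem exists_increasing_coloring_of_mem_compAll {m : ℕ} (l : List (Set PermOn))
    (hl : ∀ A ∈ l, ClassAvoids A (delta (m + 1))) (β : PermOn) (hβ : β ∈ CompAll l) :
    ∃ c : Fin β.1 → Fin (m ^ l.length), ∀ i j, i < j → c i = c j → β.2 i < β.2 j := by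
  induction l generalizing β with
  | nil =>
    have hβ : β.2 = 1 := hβ
    exact ⟨fun _ => ⟨0, by simp⟩, fun i j hij _ => by simpa [hβ] using hij⟩
  | cons A l ih =>
    obtain ⟨n, α, γ, hα, hγ, rfl⟩ := hβ
    obtain ⟨a, ha⟩ := exists_increasing_coloring α (hl A List.mem_cons_self _ hα)
    obtain ⟨c, hc⟩ := ih (fun B hB => hl B (List.mem_cons_of_mem _ hB)) _ hγ
    refine ⟨fun i => Fin.cast (by rw [List.length_cons, pow_succ])
      (finProdFinEquiv (c i, a (γ i))), fun i j hij h => ?_⟩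
    obtain ⟨h₁, h₂⟩ := Prod.mk.inj (finProdFinEquiv.injective (Fin.cast_injective _ h))
    exact ha _ _ (hc i j hij h₁) h₂

/-- A permutation whose entries are colored with `K` colors, all of whose monochromatic patterns
lie in `A`, is a merge of `K` elements of `A`. -/
theorem mem_mergeAll_replicate_of_coloring (A : Set PermOn) (K : ℕ) (σ : PermOn)
    (c : Fin σ.1 → ℕ) (hc : ∀ i, c i < K)
    (h : ∀ (τ : PermOn) (f : Fin τ.1 ↪o Fin σ.1),
      (∀ u v, τ.2 u < τ.2 v ↔ σ.2 (f u) < σ.2 (f v)) → (∀ u v, c (f u) = c (f v)) → τ ∈ A) :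
    σ ∈ MergeAll (List.replicate K A) := by
  induction K generalizing σ with
  | zero =>
    change σ.1 = 0
    by_contra hne
    exact (Nat.not_lt_zero _) (hc ⟨0, Nat.pos_of_ne_zero hne⟩)
  | succ K ih =>
    obtain ⟨α, f, hf, hα⟩ := exists_pattern_of_finset σ.2 {i | c i = K}
    obtain ⟨β, g, hg, hβ⟩ := exists_pattern_of_finset σ.2 {i | c i < K}
    simp only [Finset.mem_filter, Finset.mem_univ, true_and] at hf hg
    have hfK : ∀ u, c (f u) = K := fun u => (hf _).1 ⟨u, rfl⟩
    have hgK : ∀ u, c (g u) < K := fun u => (hg _).1 ⟨u, rfl⟩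
    refine ⟨α, h α f hα fun u v => by rw [hfK, hfK], β, ?_, f, g, ?_, ?_, hα, hβ⟩
    · refine ih β (fun u => c (g u)) hgK fun τ e he hce => h τ (e.trans g) ?_ hce
      exact fun u v => (he u v).trans (hβ _ _)
    · intro u v huv
      exact (hgK v).ne (huv ▸ hfK u)
    · intro i
      rw [hf, hg]
      have := hc i
      omega

/-- If a permutation class `C` avoiding `δ_{m+1}` satisfies
`C ⊆ A₁ ∘ A₂ ∘ ⋯ ∘ A_k` with each `A_i` a subclass of `C`, then `C` is
contained in the merge of `m^(k-1)` copies of `A₁`. -/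
theorem stmt_15 (m : ℕ) (C : Set PermOn) (hC : IsPermClass C)
    (hav : ClassAvoids C (delta (m + 1)))
    (A₁ : Set PermOn) (rest : List (Set PermOn))
    (hsub : ∀ A ∈ A₁ :: rest, IsPermClass A ∧ A ⊆ C)
    (hcomp : C ⊆ CompAll (A₁ :: rest)) :
    C ⊆ MergeAll (List.replicate (m ^ rest.length) A₁) := by
  intro σ hσ
  obtain ⟨n, α, β, hα, hβ, rfl⟩ := hcomp hσ
  obtain ⟨c, hc⟩ := exists_increasing_coloring_of_mem_compAll rest
    (fun A hA π hπ => hav π ((hsub A (List.mem_cons_of_mem _ hA)).2 hπ)) _ hβ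
  refine mem_mergeAll_replicate_of_coloring A₁ _ _ (fun i => (c i : ℕ)) (fun i => (c i).2)
    fun τ f hf hcf => (hsub A₁ List.mem_cons_self).1 _ hα τ ?_
  have hmono : StrictMono fun u => β (f u) := fun u v huv =>
    hc _ _ (f.strictMono huv) (Fin.ext (hcf u v))
  exact ⟨OrderEmbedding.ofStrictMono _ hmono, hf⟩
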